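/- (Theorem 3, existence) Let Φ be a positive trace-preserving real-linear map on Hermitian 2×2 matrices. Then there exists w₀ ∈ ℝ such that the real symmetric 4×4 matrix Q_{w₀} of the quadratic form q_{w₀}(x) = Φ(x)·Φ(x) − w₀ x·x is positive semidefinite, has nontrivial kernel, and its kernel contains a nonzero vector n with n·n ≤ 0 (space-like or light-like with respect to the Minkowski inner product). -/

import Mathlib

open scoped Matrix ComplexOrder
open Matrix

noncomputable section

/-- Pauli matrix σ₁ -/
def pauli1 : Matrix (Fin 2) (Fin 2) ℂ := !![0, 1; 1, 0]
/-- Pauli matrix σ₂ -/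
def pauli2 : Matrix (Fin 2) (Fin 2) ℂ := !![0, -Complex.I; Complex.I, 0]
/-- Pauli matrix σ₃ -/
def pauli3 : Matrix (Fin 2) (Fin 2) ℂ := !![1, 0; 0, -1]

/-- The map x ↦ ½(x₀ I + x₁σ₁ + x₂σ₂ + x₃σ₃). -/
def toMat (x : Fin 4 → ℝ) : Matrix (Fin 2) (Fin 2) ℂ :=
  (1 / 2 : ℂ) • ((x 0 : ℂ) • (1 : Matrix (Fin 2) (Fin 2) ℂ) +
    (x 1 : ℂ) • pauli1 + (x 2 : ℂ) • pauli2 + (x 3 : ℂ) • pauli3)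

/-- Minkowski inner product on ℝ⁴. -/
def mink (x y : Fin 4 → ℝ) : ℝ := x 0 * y 0 - x 1 * y 1 - x 2 * y 2 - x 3 * y 3

/-- Bloch-picture action of a trace-preserving linear map:
(x₀, x⃗) ↦ (x₀, x₀ t⃗ + Λ x⃗). -/
def phiVec (t : Fin 3 → ℝ) (Λ : Matrix (Fin 3) (Fin 3) ℝ) (x : Fin 4 → ℝ) : Fin 4 → ℝ :=
  ![x 0,
    x 0 * t 0 + ∑ j : Fin 3, Λ 0 j * x j.succ,
    x 0 * t 1 + ∑ j : Fin 3, Λ 1 j * x j.succ,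
    x 0 * t 2 + ∑ j : Fin 3, Λ 2 j * x j.succ]

/-- The quadratic form q_w(x) = Φ(x)·Φ(x) − w x·x. -/
def qform (t : Fin 3 → ℝ) (Λ : Matrix (Fin 3) (Fin 3) ℝ) (w : ℝ) (x : Fin 4 → ℝ) : ℝ :=
  mink (phiVec t Λ x) (phiVec t Λ x) - w * mink x x

/-- Positivity of the map in the Bloch picture: positive semidefinite matrices are
mapped to positive semidefinite matrices. -/
def IsPosMap (t : Fin 3 → ℝ) (Λ : Matrix (Fin 3) (Fin 3) ℝ) : Prop :=
  ∀ x : Fin 4 → ℝ, (toMat x).PosSemidef → (toMat (phiVec t Λ x)).PosSemidef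

/-- x is the Bloch vector of a qubit state. -/
def IsStateVec (x : Fin 4 → ℝ) : Prop := (toMat x).PosSemidef ∧ x 0 = 1

/-- x is the Bloch vector of a pure qubit state (determinant zero, i.e. x·x = 0). -/
def IsPureVec (x : Fin 4 → ℝ) : Prop := (toMat x).PosSemidef ∧ x 0 = 1 ∧ mink x x = 0

/-- Concurrence of a pure state: C_Φ(π) = 2√(det Φ(π)). -/
def pureConc (t : Fin 3 → ℝ) (Λ : Matrix (Fin 3) (Fin 3) ℝ) (y : Fin 4 → ℝ) : ℝ :=
  2 * Real.sqrt ((toMat (phiVec t Λ y)).det.re)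

/-- Concurrence of a (mixed) state with Bloch vector x: the infimum over finite
convex decompositions into pure states of the average pure-state concurrence. -/
def conc (t : Fin 3 → ℝ) (Λ : Matrix (Fin 3) (Fin 3) ℝ) (x : Fin 4 → ℝ) : ℝ :=
  sInf {c : ℝ | ∃ (k : ℕ) (p : Fin k → ℝ) (y : Fin k → (Fin 4 → ℝ)),
    (∀ j, 0 < p j) ∧ (∑ j, p j) = 1 ∧ (∀ j, IsPureVec (y j)) ∧
    (∀ i, (∑ j, p j * y j i) = x i) ∧ c = ∑ j, p j * pureConc t Λ (y j)}

end

/-- The Minkowski metric as a diagonal matrix. -/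
def minkMatrix : Matrix (Fin 4) (Fin 4) ℝ := diagonal ![1, -1, -1, -1]

lemma dotProduct_minkMatrix_mulVec (x y : Fin 4 → ℝ) :
    x ⬝ᵥ minkMatrix *ᵥ y = mink x y := by
  simp [minkMatrix, mink, dotProduct, mulVec_diagonal, Fin.sum_univ_four]
  ring

lemma continuous_mink_self : Continuous fun x : Fin 4 → ℝ => mink x x := by
  unfold mink
  fun_prop

lemma mink_self_smul (c : ℝ) (x : Fin 4 → ℝ) : mink (c • x) (c • x) = c ^ 2 * mink x x := by
  simp only [mink, Pi.smul_apply, smul_eq_mul]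
  ring

lemma mink_self_add_smul (s : ℝ) (x y : Fin 4 → ℝ) :
    mink (x + s • y) (x + s • y) = mink x x + 2 * s * mink x y + s ^ 2 * mink y y := by
  simp only [mink, Pi.add_apply, Pi.smul_apply, smul_eq_mul]
  ring

lemma neg_three_mul_norm_sq_le_mink_self (x : Fin 4 → ℝ) : -(3 * ‖x‖ ^ 2) ≤ mink x x := by
  have h (i : Fin 4) : x i ^ 2 ≤ ‖x‖ ^ 2 :=
    sq_le_sq' (neg_le_of_abs_le (norm_le_pi_norm x i)) (le_of_abs_le (norm_le_pi_norm x i))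
  have h1 := h 1
  have h2 := h 2
  have h3 := h 3
  unfold mink
  nlinarith [sq_nonneg (x 0)]

/-- If `s ↦ p + s q + s² r` is nonnegative at both roots of `-a + 2 b s + c s²`, where `a, c > 0`,
then `c p + a r ≥ 0`. -/
lemma nonneg_combination_of_nonneg_at_roots {a b c p q r : ℝ} (ha : 0 < a) (hc : 0 < c)
    (h : ∀ s : ℝ, -a + 2 * s * b + s ^ 2 * c = 0 → 0 ≤ p + s * q + s ^ 2 * r) :
    0 ≤ c * p + a * r := by
  set d := Real.sqrt (b ^ 2 + a * c)
  have hac : 0 < a * c := mul_pos ha hc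
  have hd : d ^ 2 = b ^ 2 + a * c := Real.sq_sqrt (by positivity)
  have hbd : |b| < d := Real.lt_sqrt_of_sq_lt (by rw [sq_abs]; linarith)
  obtain ⟨hb₁, hb₂⟩ := abs_lt.mp hbd
  have root (e : ℝ) (he : e ^ 2 = b ^ 2 + a * c) :
      0 ≤ c * p + a * r + (e - b) / c * (c * q - 2 * b * r) := by
    have hs : -a + 2 * ((e - b) / c) * b + ((e - b) / c) ^ 2 * c = 0 := by
      field_simp
      linarith
    have := mul_nonneg hc.le (h _ hs)
    linear_combination this + r * hs
  have h₁ := root d hd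
  have h₂ := root (-d) (by rw [neg_sq, hd])
  have hs₁ : 0 < (d - b) / c := div_pos (by linarith) hc
  have hs₂ : (-d - b) / c < 0 := div_neg_of_neg_of_pos (by linarith) hc
  rcases le_total 0 (c * q - 2 * b * r) with hk | hk
  · nlinarith [mul_nonneg (neg_nonneg.mpr hs₂.le) hk]
  · nlinarith [mul_nonneg hs₁.le (neg_nonneg.mpr hk)]

lemma quadForm_add_smul (A : Matrix (Fin 4) (Fin 4) ℝ) (s : ℝ) (x y : Fin 4 → ℝ) :
    (x + s • y) ⬝ᵥ A *ᵥ (x + s • y) =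
      x ⬝ᵥ A *ᵥ x + s * (x ⬝ᵥ A *ᵥ y + y ⬝ᵥ A *ᵥ x) + s ^ 2 * (y ⬝ᵥ A *ᵥ y) := by
  simp only [mulVec_add, mulVec_smul, dotProduct_add, add_dotProduct, dotProduct_smul,
    smul_dotProduct, smul_eq_mul]
  ring

/-- A form that is nonnegative on the light cone has Rayleigh quotients with respect to the
Minkowski form that are no larger on space-like vectors than on time-like ones. -/
lemma div_mink_le_div_mink {A : Matrix (Fin 4) (Fin 4) ℝ}
    (hA : ∀ x, mink x x = 0 → 0 ≤ x ⬝ᵥ A *ᵥ x) {x y : Fin 4 → ℝ}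
    (hx : mink x x < 0) (hy : 0 < mink y y) :
    (x ⬝ᵥ A *ᵥ x) / mink x x ≤ (y ⬝ᵥ A *ᵥ y) / mink y y := by
  have key : 0 ≤ mink y y * (x ⬝ᵥ A *ᵥ x) + -mink x x * (y ⬝ᵥ A *ᵥ y) := by
    refine nonneg_combination_of_nonneg_at_roots (b := mink x y)
      (q := x ⬝ᵥ A *ᵥ y + y ⬝ᵥ A *ᵥ x) (neg_pos.mpr hx) hy fun s hs => ?_
    rw [← quadForm_add_smul]
    apply hA
    rw [mink_self_add_smul]
    linarith
  rw [div_le_iff_of_neg hx, div_mul_eq_mul_div, div_le_iff₀ hy]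
  linarith

lemma quadForm_sub_smul_minkMatrix (A : Matrix (Fin 4) (Fin 4) ℝ) (w : ℝ) (x : Fin 4 → ℝ) :
    x ⬝ᵥ (A - w • minkMatrix) *ᵥ x = x ⬝ᵥ A *ᵥ x - w * mink x x := by
  rw [sub_mulVec, dotProduct_sub, smul_mulVec, dotProduct_smul, dotProduct_minkMatrix_mulVec,
    smul_eq_mul]

/-- The S-lemma for the light cone, with a kernel vector that is not time-like. -/
theorem exists_posSemidef_sub_smul_minkMatrix {A : Matrix (Fin 4) (Fin 4) ℝ} (hsymm : A.IsSymm)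
    (hA : ∀ x, mink x x = 0 → 0 ≤ x ⬝ᵥ A *ᵥ x) :
    ∃ w : ℝ, (A - w • minkMatrix).PosSemidef ∧
      ∃ n : Fin 4 → ℝ, n ≠ 0 ∧ (A - w • minkMatrix) *ᵥ n = 0 ∧ mink n n ≤ 0 := by
  let S : Set ℝ := {r | ∃ x, mink x x < 0 ∧ (x ⬝ᵥ A *ᵥ x) / mink x x = r}
  have he : mink ![0, 1, 0, 0] ![0, 1, 0, 0] < 0 := by simp [mink]
  have hS : S.Nonempty := ⟨_, _, he, rfl⟩
  have hub {y : Fin 4 → ℝ} (hy : 0 < mink y y) :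
      (y ⬝ᵥ A *ᵥ y) / mink y y ∈ upperBounds S := by
    rintro _ ⟨x, hx, rfl⟩
    exact div_mink_le_div_mink hA hx hy
  have hbdd : BddAbove S := ⟨_, hub (y := ![1, 0, 0, 0]) (by simp [mink])⟩
  set w := sSup S
  have hq := quadForm_sub_smul_minkMatrix A w
  have hnonneg (x : Fin 4 → ℝ) : 0 ≤ x ⬝ᵥ (A - w • minkMatrix) *ᵥ x := by
    rw [hq]
    rcases lt_trichotomy (mink x x) 0 with hx | hx | hx
    · have : (x ⬝ᵥ A *ᵥ x) / mink x x ≤ w := le_csSup hbdd ⟨x, hx, rfl⟩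
      rw [div_le_iff_of_neg hx] at this
      linarith
    · rw [hx, mul_zero, sub_zero]
      exact hA x hx
    · have : w ≤ (x ⬝ᵥ A *ᵥ x) / mink x x := csSup_le hS (hub hx)
      rw [le_div_iff₀ hx] at this
      linarith
  have hherm : (A - w • minkMatrix).IsHermitian := by
    rw [isHermitian_iff_isSymm]
    exact hsymm.sub ((isSymm_diagonal _).smul w)
  have hpsd : (A - w • minkMatrix).PosSemidef :=
    .of_dotProduct_mulVec_nonneg hherm fun x => by simpa using hnonneg x
  refine ⟨w, hpsd, ?_⟩
  let K : Set (Fin 4 → ℝ) := Metric.sphere 0 1 ∩ {x | mink x x ≤ 0}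
  have hK : IsCompact K :=
    (isCompact_sphere 0 1).inter_right (isClosed_le continuous_mink_self continuous_const)
  have normalize_mem {x : Fin 4 → ℝ} (hx : mink x x < 0) : ‖x‖⁻¹ • x ∈ K := by
    have hx0 : x ≠ 0 := by
      rintro rfl
      simp [mink] at hx
    refine ⟨by simp [norm_smul, hx0], ?_⟩
    rw [Set.mem_ofPred_eq, mink_self_smul]
    exact mul_nonpos_of_nonneg_of_nonpos (sq_nonneg _) hx.le
  obtain ⟨n, hnK, hmin⟩ := hK.exists_isMinOn ⟨_, normalize_mem he⟩
    (f := fun x => x ⬝ᵥ (A - w • minkMatrix) *ᵥ x)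
    (by simp only [dotProduct, mulVec]; fun_prop)
  have hn1 : ‖n‖ = 1 := by simpa using hnK.1
  have hn0 : n ≠ 0 := norm_ne_zero_iff.mp (by rw [hn1]; exact one_ne_zero)
  refine ⟨n, hn0, ?_, hnK.2⟩
  suffices h : n ⬝ᵥ (A - w • minkMatrix) *ᵥ n = 0 from
    (hpsd.dotProduct_mulVec_zero_iff n).mp (by simpa using h)
  by_contra hne
  set δ := n ⬝ᵥ (A - w • minkMatrix) *ᵥ n
  have hδ : 0 < δ := lt_of_le_of_ne (hnonneg n) (Ne.symm hne)
  have hw : w ≤ w - δ / 3 := by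
    refine csSup_le hS ?_
    rintro _ ⟨x, hx, rfl⟩
    have hx0 : 0 < ‖x‖ := by
      rw [norm_pos_iff]
      rintro rfl
      simp [mink] at hx
    have h : δ ≤ (‖x‖⁻¹ • x) ⬝ᵥ (A - w • minkMatrix) *ᵥ (‖x‖⁻¹ • x) := hmin (normalize_mem hx)
    rw [mulVec_smul, dotProduct_smul, smul_dotProduct, smul_eq_mul, smul_eq_mul, ← mul_assoc,
      ← mul_inv, le_inv_mul_iff₀ (by positivity), hq] at h
    rw [div_le_iff_of_neg hx]
    nlinarith [mul_le_mul_of_nonneg_left (neg_three_mul_norm_sq_le_mink_self x) hδ.le]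
  linarith

lemma toMat_mul_self (x : Fin 4 → ℝ) (hx : mink x x = 0) :
    toMat x * toMat x = (x 0 : ℂ) • toMat x := by
  have h : (x 0 * x 0 - x 1 * x 1 - x 2 * x 2 - x 3 * x 3 : ℂ) = 0 := by exact_mod_cast hx
  ext i j
  fin_cases i <;> fin_cases j <;>
    simp [toMat, pauli1, pauli2, pauli3, Matrix.mul_apply, Fin.sum_univ_two] <;> ring_nf <;>
    simp only [Complex.I_sq] <;> linear_combination (-1 / 4 : ℂ) * h

lemma isHermitian_toMat (x : Fin 4 → ℝ) : (toMat x).IsHermitian := by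
  ext i j
  fin_cases i <;> fin_cases j <;> simp [toMat, pauli1, pauli2, pauli3] <;> ring

lemma posSemidef_toMat {x : Fin 4 → ℝ} (h0 : 0 ≤ x 0) (hx : mink x x = 0) :
    (toMat x).PosSemidef := by
  rcases h0.eq_or_lt with h | h
  · have hx' : x 1 ^ 2 + x 2 ^ 2 + x 3 ^ 2 = 0 := by
      unfold mink at hx
      rw [← h] at hx
      linarith
    have h1 : x 1 = 0 := by nlinarith [sq_nonneg (x 1), sq_nonneg (x 2), sq_nonneg (x 3)]
    have h2 : x 2 = 0 := by nlinarith [sq_nonneg (x 1), sq_nonneg (x 2), sq_nonneg (x 3)]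
    have h3 : x 3 = 0 := by nlinarith [sq_nonneg (x 1), sq_nonneg (x 2), sq_nonneg (x 3)]
    have : toMat x = 0 := by simp [toMat, ← h, h1, h2, h3]
    rw [this]
    exact .zero
  · have hne : (x 0 : ℂ) ≠ 0 := by exact_mod_cast h.ne'
    have : toMat x = (x 0)⁻¹ • ((toMat x)ᴴ * toMat x) := by
      rw [isHermitian_toMat x, toMat_mul_self x hx, ← Complex.coe_smul, smul_smul,
        Complex.ofReal_inv, inv_mul_cancel₀ hne, one_smul]
    rw [this]
    exact (posSemidef_conjTranspose_mul_self _).smul (inv_nonneg.mpr h.le)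

lemma det_toMat (x : Fin 4 → ℝ) : (toMat x).det = ((mink x x / 4 : ℝ) : ℂ) := by
  rw [det_fin_two]
  simp [toMat, pauli1, pauli2, pauli3, mink]
  ring_nf
  simp only [Complex.I_sq]
  ring

lemma mink_self_nonneg_of_posSemidef {x : Fin 4 → ℝ} (h : (toMat x).PosSemidef) :
    0 ≤ mink x x := by
  have := h.det_nonneg
  rw [det_toMat, Complex.zero_le_real] at this
  linarith

lemma phiVec_neg (t : Fin 3 → ℝ) (Λ : Matrix (Fin 3) (Fin 3) ℝ) (x : Fin 4 → ℝ) :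
    phiVec t Λ (-x) = -phiVec t Λ x := by
  ext i
  fin_cases i <;> simp [phiVec] <;> ring

lemma mink_neg_neg (x : Fin 4 → ℝ) : mink (-x) (-x) = mink x x := by
  simp [mink]

lemma IsPosMap.mink_phiVec_nonneg {t : Fin 3 → ℝ} {Λ : Matrix (Fin 3) (Fin 3) ℝ}
    (hpos : IsPosMap t Λ) {x : Fin 4 → ℝ} (hx : mink x x = 0) :
    0 ≤ mink (phiVec t Λ x) (phiVec t Λ x) := by
  rcases le_total 0 (x 0) with h0 | h0
  · exact mink_self_nonneg_of_posSemidef (hpos x (posSemidef_toMat h0 hx))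
  · rw [← mink_neg_neg, ← phiVec_neg]
    refine mink_self_nonneg_of_posSemidef (hpos _ (posSemidef_toMat ?_ ?_))
    · simpa using h0
    · rwa [mink_neg_neg]

/-- The matrix of `phiVec t Λ`. -/
def phiMatrix (t : Fin 3 → ℝ) (Λ : Matrix (Fin 3) (Fin 3) ℝ) : Matrix (Fin 4) (Fin 4) ℝ :=
  !![1, 0, 0, 0;
    t 0, Λ 0 0, Λ 0 1, Λ 0 2;
    t 1, Λ 1 0, Λ 1 1, Λ 1 2;
    t 2, Λ 2 0, Λ 2 1, Λ 2 2]

lemma phiMatrix_mulVec (t : Fin 3 → ℝ) (Λ : Matrix (Fin 3) (Fin 3) ℝ) (x : Fin 4 → ℝ) :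
    phiMatrix t Λ *ᵥ x = phiVec t Λ x := by
  ext i
  fin_cases i <;>
    simp [phiMatrix, phiVec, mulVec, dotProduct, Fin.sum_univ_succ] <;> ring

lemma quadForm_phiMatrix (t : Fin 3 → ℝ) (Λ : Matrix (Fin 3) (Fin 3) ℝ) (x : Fin 4 → ℝ) :
    x ⬝ᵥ ((phiMatrix t Λ)ᵀ * minkMatrix * phiMatrix t Λ) *ᵥ x =
      mink (phiVec t Λ x) (phiVec t Λ x) := by
  rw [← dotProduct_minkMatrix_mulVec, ← phiMatrix_mulVec, ← mulVec_mulVec, ← mulVec_mulVec,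
    dotProduct_mulVec, vecMul_transpose]

/-- Theorem 3, existence: for every positive trace-preserving map Φ
there exists w₀ such that the symmetric matrix Q_{w₀} of the form
q_{w₀}(x) = Φ(x)·Φ(x) − w₀ x·x is positive semidefinite, has nontrivial kernel,
and its kernel contains a nonzero vector n with n·n ≤ 0. -/
theorem stmt9 (t : Fin 3 → ℝ) (Λ : Matrix (Fin 3) (Fin 3) ℝ) (hpos : IsPosMap t Λ) :
    ∃ (w₀ : ℝ) (Q : Matrix (Fin 4) (Fin 4) ℝ), Q.IsSymm ∧
      (∀ x : Fin 4 → ℝ, x ⬝ᵥ Q.mulVec x = qform t Λ w₀ x) ∧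
      Q.PosSemidef ∧
      ∃ n : Fin 4 → ℝ, n ≠ 0 ∧ Q.mulVec n = 0 ∧ mink n n ≤ 0 := by
  have hsymm : ((phiMatrix t Λ)ᵀ * minkMatrix * phiMatrix t Λ).IsSymm := by
    simp [Matrix.IsSymm, minkMatrix, Matrix.mul_assoc]
  obtain ⟨w, hpsd, hn⟩ := exists_posSemidef_sub_smul_minkMatrix hsymm fun x hx => by
    rw [quadForm_phiMatrix]
    exact hpos.mink_phiVec_nonneg hx
  refine ⟨w, _, isHermitian_iff_isSymm.mp hpsd.isHermitian, fun x => ?_, hpsd, hn⟩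
  rw [quadForm_sub_smul_minkMatrix, quadForm_phiMatrix, qform]
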